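/- Let G be the graph with vertex set {1,2,3,4,5} and edge set {{1,2},{2,3},{3,4},{1,3},{1,4},{2,5},{4,5}}. For every generic edge-length assignment λ : E(G) → ℝ_{>0}, the set of congruence classes of spherical realizations of G inducing λ has exactly 8 elements. -/

import Mathlib

/-- A finite simple graph: vertices are a finite set of naturals, edges are
two-element subsets of the vertex set. -/
structure GeoGraph where
  V : Finset ℕ
  E : Finset (Finset ℕ)
  edge_sub : ∀ e ∈ E, e ⊆ V
  edge_two : ∀ e ∈ E, e.card = 2

def IsSubgraph (G' G : GeoGraph) : Prop :=
  G'.V ⊆ G.V ∧ G'.E ⊆ G.E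

/-- The Laman conditions: `|E| = 2|V| - 3` and every subgraph with at least two
vertices satisfies `|E'| ≤ 2|V'| - 3`. -/
def Laman (G : GeoGraph) : Prop :=
  2 ≤ G.V.card ∧ G.E.card = 2 * G.V.card - 3 ∧
    ∀ G' : GeoGraph, IsSubgraph G' G → 2 ≤ G'.V.card → G'.E.card ≤ 2 * G'.V.card - 3

/-- A generic edge-length assignment: positive real edge lengths that are
algebraically independent over ℚ. -/
def Generic (G : GeoGraph) (lam : Finset ℕ → ℝ) : Prop :=
  (∀ e ∈ G.E, 0 < lam e) ∧
    AlgebraicIndependent ℚ (fun e : G.E => lam e.1)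

/-- A spherical realization: every vertex goes to the complex sphere. -/
def SphereRealization (G : GeoGraph) (ρ : ℕ → Fin 3 → ℂ) : Prop :=
  ∀ v ∈ G.V, ∑ i, ρ v i ^ 2 = 1

/-- A realization induces the edge lengths `lam`. -/
def SphereInduces (G : GeoGraph) (ρ : ℕ → Fin 3 → ℂ) (lam : Finset ℕ → ℝ) : Prop :=
  ∀ u v : ℕ, ({u, v} : Finset ℕ) ∈ G.E →
    ∑ i, (ρ u i - ρ v i) ^ 2 = (lam {u, v} : ℂ)

/-- Congruence of spherical realizations via `SO₃(ℂ)`. -/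
def SphereCongruent (G : GeoGraph) (ρ ρ' : ℕ → Fin 3 → ℂ) : Prop :=
  ∃ A : Matrix (Fin 3) (Fin 3) ℂ, A * A.transpose = 1 ∧ A.det = 1 ∧
    ∀ v ∈ G.V, ρ' v = A.mulVec (ρ v)

/-- Congruence classes of spherical realizations of `G` inducing `lam`. -/
def SphereClasses (G : GeoGraph) (lam : Finset ℕ → ℝ) : Type :=
  Quot fun ρ ρ' : {ρ : ℕ → Fin 3 → ℂ // SphereRealization G ρ ∧ SphereInduces G ρ lam} =>
    SphereCongruent G ρ.1 ρ'.1

def PlaneInduces (G : GeoGraph) (ρ : ℕ → Fin 2 → ℂ) (lam : Finset ℕ → ℝ) : Prop :=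
  ∀ u v : ℕ, ({u, v} : Finset ℕ) ∈ G.E →
    ∑ i, (ρ u i - ρ v i) ^ 2 = (lam {u, v} : ℂ)

/-- Congruence of plane realizations via `SO₂(ℂ)` and a translation. -/
def PlaneCongruent (G : GeoGraph) (ρ ρ' : ℕ → Fin 2 → ℂ) : Prop :=
  ∃ A : Matrix (Fin 2) (Fin 2) ℂ, ∃ b : Fin 2 → ℂ, A * A.transpose = 1 ∧ A.det = 1 ∧
    ∀ v ∈ G.V, ρ' v = A.mulVec (ρ v) + b

/-- Congruence classes of plane realizations of `G` inducing `lam`. -/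
def PlaneClasses (G : GeoGraph) (lam : Finset ℕ → ℝ) : Type :=
  Quot fun ρ ρ' : {ρ : ℕ → Fin 2 → ℂ // PlaneInduces G ρ lam} =>
    PlaneCongruent G ρ.1 ρ'.1

/-- A calligraph: `{0,1,2} ⊆ V`, `{1,2} ∈ E`, `|E| = 2|V| - 4`, and adding the
edge `{0,1}` or the edge `{0,2}` yields a graph satisfying the Laman conditions. -/
def Calligraph (H : GeoGraph) : Prop :=
  ({0, 1, 2} : Finset ℕ) ⊆ H.V ∧ ({1, 2} : Finset ℕ) ∈ H.E ∧
    H.E.card = 2 * H.V.card - 4 ∧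
    ((∃ H' : GeoGraph, H'.V = H.V ∧ H'.E = insert {0, 1} H.E ∧ Laman H') ∨
     (∃ H' : GeoGraph, H'.V = H.V ∧ H'.E = insert {0, 2} H.E ∧ Laman H'))

/-- A split of `G` into two subgraphs sharing exactly the vertices `0,1,2` and
the edge `{1,2}`. -/
def IsSplit (G G₁ G₂ : GeoGraph) : Prop :=
  G.V = G₁.V ∪ G₂.V ∧ G.E = G₁.E ∪ G₂.E ∧
    G₁.V ∩ G₂.V = ({0, 1, 2} : Finset ℕ) ∧
    G₁.E ∩ G₂.E = ({{1, 2}} : Finset (Finset ℕ))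

/-- A calligraphic split: a split into two calligraphs. -/
def CalligraphicSplit (G G₁ G₂ : GeoGraph) : Prop :=
  IsSplit G G₁ G₂ ∧ Calligraph G₁ ∧ Calligraph G₂

/-- The graph with vertices `{1,2,3,4,5}` and edges
`{1,2},{2,3},{3,4},{1,3},{1,4},{2,5},{4,5}`. -/
def G6 : GeoGraph where
  V := {1, 2, 3, 4, 5}
  E := {{1, 2}, {2, 3}, {3, 4}, {1, 3}, {1, 4}, {2, 5}, {4, 5}}
  edge_sub := by decide
  edge_two := by decide

open Matrix

/-- The Gram determinant of three unit vectors with pairwise inner products `a`, `b`, `c`. -/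
def unitGram {R : Type*} [CommRing R] (a b c : R) : R :=
  1 + 2 * a * b * c - a ^ 2 - b ^ 2 - c ^ 2

/-- For unit vectors `p`, `q`, `x`, `y`, with `p ⬝ᵥ q = c`, `p ⬝ᵥ x = a`, `q ⬝ᵥ x = b`,
`p ⬝ᵥ y = e`, `q ⬝ᵥ y = f`, the part of `det (p, q, x) * det (p, q, y)` that does not involve
`x ⬝ᵥ y`. -/
def hingeOffset {R : Type*} [CommRing R] (a b c e f : R) : R :=
  c * f * a + c * e * b - e * a - f * b

/-- The elimination of `t` from `((1 - c ^ 2) * t + hingeOffset a b c e f) ^ 2 =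
unitGram a b c * unitGram e f c` and `unitGram g h t = 0`. -/
def hingeResultant {R : Type*} [CommRing R] (a b c e f g h : R) : R :=
  let k := 1 - c ^ 2
  let s := hingeOffset a b c e f
  let m := g ^ 2 + h ^ 2 - 1
  let M := k ^ 2 * m + unitGram a b c * unitGram e f c - s ^ 2
  let L := 2 * k * s + 2 * k ^ 2 * g * h
  M ^ 2 - 2 * g * h * M * L + m * L ^ 2

theorem hingeResultant_eq_zero {R : Type*} [CommRing R] {a b c e f g h x y t : R}
    (hx : x ^ 2 = unitGram a b c) (hy : y ^ 2 = unitGram e f c)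
    (hxy : x * y = (1 - c ^ 2) * t + hingeOffset a b c e f) (ht : unitGram g h t = 0) :
    hingeResultant a b c e f g h = 0 := by
  have hsq : ((1 - c ^ 2) * t + hingeOffset a b c e f) ^ 2 = unitGram a b c * unitGram e f c := by
    rw [← hxy, ← hx, ← hy]; ring
  unfold hingeResultant
  generalize hingeOffset a b c e f = s at *
  generalize unitGram a b c * unitGram e f c = w at *
  generalize 1 - c ^ 2 = k at *
  unfold unitGram at ht
  have hlin : k ^ 2 * (g ^ 2 + h ^ 2 - 1) + w - s ^ 2 = (2 * k * s + 2 * k ^ 2 * g * h) * t := by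
    linear_combination -hsq - k ^ 2 * ht
  simp only [hlin]
  linear_combination -(2 * k * s + 2 * k ^ 2 * g * h) ^ 2 * ht

theorem AlgebraicIndependent.aeval_ne_zero_of_eval_ne_zero {ι R A : Type*} [CommRing R]
    [CommRing A] [Algebra R A] {x : ι → A} (hx : AlgebraicIndependent R x)
    {P : MvPolynomial ι R} (pt : ι → R) (hP : MvPolynomial.eval pt P ≠ 0) :
    MvPolynomial.aeval x P ≠ 0 := fun h => hP (by rw [hx.eq_zero_of_aeval_eq_zero P h, map_zero])

section Vectors

variable {K : Type*} [Field K]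

/-- The determinant of the matrix with rows `p`, `q`, `x`. -/
def tripleDet (p q x : Fin 3 → K) : K := (Matrix.of ![p, q, x]).det

theorem tripleDet_eq (p q x : Fin 3 → K) :
    tripleDet p q x = p 0 * q 1 * x 2 - p 0 * q 2 * x 1 - p 1 * q 0 * x 2 + p 1 * q 2 * x 0
      + p 2 * q 0 * x 1 - p 2 * q 1 * x 0 := by
  simp [tripleDet, Matrix.det_fin_three]

theorem dotProduct_eq_three (p q : Fin 3 → K) :
    p ⬝ᵥ q = p 0 * q 0 + p 1 * q 1 + p 2 * q 2 := by
  simp [dotProduct, Fin.sum_univ_three]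

theorem tripleDet_mulVec (A : Matrix (Fin 3) (Fin 3) K) (p q x : Fin 3 → K) :
    tripleDet (A *ᵥ p) (A *ᵥ q) (A *ᵥ x) = A.det * tripleDet p q x := by
  have : (Matrix.of ![A *ᵥ p, A *ᵥ q, A *ᵥ x]) = Matrix.of ![p, q, x] * Aᵀ := by
    ext i j
    fin_cases i <;> simp [Matrix.mul_apply, mulVec, dotProduct, mul_comm]
  rw [tripleDet, this, det_mul, det_transpose, mul_comm]; rfl

theorem mulVec_dotProduct_mulVec {A : Matrix (Fin 3) (Fin 3) K} (hA : A * Aᵀ = 1)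
    (p q : Fin 3 → K) : (A *ᵥ p) ⬝ᵥ (A *ᵥ q) = p ⬝ᵥ q := by
  rw [dotProduct_mulVec, ← mulVec_transpose, mulVec_mulVec, mul_eq_one_comm.mp hA, one_mulVec]

/-- The Cauchy–Binet identity for two triples sharing two vectors. -/
theorem tripleDet_mul_tripleDet {p q x y : Fin 3 → K} (hp : p ⬝ᵥ p = 1) (hq : q ⬝ᵥ q = 1) :
    tripleDet p q x * tripleDet p q y = (1 - (p ⬝ᵥ q) ^ 2) * (x ⬝ᵥ y) +
      hingeOffset (p ⬝ᵥ x) (q ⬝ᵥ x) (p ⬝ᵥ q) (p ⬝ᵥ y) (q ⬝ᵥ y) := by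
  have key : tripleDet p q x * tripleDet p q y =
      ((p ⬝ᵥ p) * (q ⬝ᵥ q) - (p ⬝ᵥ q) ^ 2) * (x ⬝ᵥ y) +
      ((p ⬝ᵥ q) * (q ⬝ᵥ y) * (p ⬝ᵥ x) + (p ⬝ᵥ q) * (p ⬝ᵥ y) * (q ⬝ᵥ x)
        - (q ⬝ᵥ q) * ((p ⬝ᵥ y) * (p ⬝ᵥ x)) - (p ⬝ᵥ p) * ((q ⬝ᵥ y) * (q ⬝ᵥ x))) := by
    simp only [tripleDet_eq, dotProduct_eq_three]; ring
  rw [key, hp, hq, hingeOffset]; ring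

theorem tripleDet_sq {p q x : Fin 3 → K} (hp : p ⬝ᵥ p = 1) (hq : q ⬝ᵥ q = 1)
    (hx : x ⬝ᵥ x = 1) :
    tripleDet p q x ^ 2 = unitGram (p ⬝ᵥ x) (q ⬝ᵥ x) (p ⬝ᵥ q) := by
  rw [sq, tripleDet_mul_tripleDet hp hq, hx, hingeOffset, unitGram]; ring

/-- The matrix of the coordinates `p ⬝ᵥ x`, `q ⬝ᵥ x`, `tripleDet p q x`. -/
def frame (p q : Fin 3 → K) : Matrix (Fin 3) (Fin 3) K := Matrix.of ![p, q, p ⨯₃ q]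

theorem frame_mulVec (p q x : Fin 3 → K) :
    frame p q *ᵥ x = ![p ⬝ᵥ x, q ⬝ᵥ x, tripleDet p q x] := by
  have key : (p ⨯₃ q) ⬝ᵥ x = tripleDet p q x := by
    rw [tripleDet_eq, dotProduct_eq_three, cross_apply]
    simp only [cons_val]
    ring
  ext i
  fin_cases i
  · simp [frame, mulVec]
  · simp [frame, mulVec]
  · simpa [frame, mulVec] using key

theorem det_frame {p q : Fin 3 → K} (hp : p ⬝ᵥ p = 1) (hq : q ⬝ᵥ q = 1) :
    (frame p q).det = 1 - (p ⬝ᵥ q) ^ 2 := by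
  have key : (frame p q).det = (p ⬝ᵥ p) * (q ⬝ᵥ q) - (p ⬝ᵥ q) ^ 2 := by
    simp [frame, det_fin_three, cross_apply, dotProduct_eq_three]; ring
  rw [key, hp, hq, one_mul]

theorem frame_mul_transpose {p q : Fin 3 → K} (hp : p ⬝ᵥ p = 1) (hq : q ⬝ᵥ q = 1) :
    frame p q * (frame p q)ᵀ =
      !![1, p ⬝ᵥ q, 0; p ⬝ᵥ q, 1, 0; 0, 0, 1 - (p ⬝ᵥ q) ^ 2] := by
  have hcross : (p ⨯₃ q) ⬝ᵥ (p ⨯₃ q) = 1 - (p ⬝ᵥ q) ^ 2 := by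
    rw [cross_dot_cross, hp, hq, dotProduct_comm q p]; ring
  ext i j
  change (![p, q, p ⨯₃ q] i) ⬝ᵥ (![p, q, p ⨯₃ q] j) = _
  fin_cases i <;> fin_cases j <;>
    simp [hp, hq, hcross, dotProduct_comm q p, dotProduct_comm (p ⨯₃ q)]

theorem eq_of_frame_mulVec_eq {p q x y : Fin 3 → K} (hp : p ⬝ᵥ p = 1) (hq : q ⬝ᵥ q = 1)
    (hc : 1 - (p ⬝ᵥ q) ^ 2 ≠ 0) (h : frame p q *ᵥ x = frame p q *ᵥ y) : x = y := by
  have hu : IsUnit (frame p q) := by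
    rw [isUnit_iff_isUnit_det, det_frame hp hq]; exact hc.isUnit
  exact mulVec_injective_iff_isUnit.mpr hu h

theorem exists_unit_vector {p q : Fin 3 → K} (hp : p ⬝ᵥ p = 1) (hq : q ⬝ᵥ q = 1)
    (hc : 1 - (p ⬝ᵥ q) ^ 2 ≠ 0) {a b d : K} (hd : d ^ 2 = unitGram a b (p ⬝ᵥ q)) :
    ∃ x, x ⬝ᵥ x = 1 ∧ p ⬝ᵥ x = a ∧ q ⬝ᵥ x = b ∧ tripleDet p q x = d := by
  have hu : IsUnit (frame p q) := by
    rw [isUnit_iff_isUnit_det, det_frame hp hq]; exact hc.isUnit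
  obtain ⟨x, hx⟩ := mulVec_surjective_iff_isUnit.mpr hu ![a, b, d]
  rw [frame_mulVec] at hx
  have h0 : p ⬝ᵥ x = a := congrFun hx 0
  have h1 : q ⬝ᵥ x = b := congrFun hx 1
  have h2 : tripleDet p q x = d := congrFun hx 2
  refine ⟨x, ?_, h0, h1, h2⟩
  have h := tripleDet_mul_tripleDet (x := x) (y := x) hp hq
  rw [h0, h1, h2, ← sq, hd, hingeOffset, unitGram] at h
  refine mul_left_cancel₀ hc ?_
  linear_combination -h

theorem exists_rotation {p q p' q' : Fin 3 → K} (hp : p ⬝ᵥ p = 1) (hq : q ⬝ᵥ q = 1)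
    (hp' : p' ⬝ᵥ p' = 1) (hq' : q' ⬝ᵥ q' = 1) (hpq : p' ⬝ᵥ q' = p ⬝ᵥ q)
    (hc : 1 - (p ⬝ᵥ q) ^ 2 ≠ 0) :
    ∃ A : Matrix (Fin 3) (Fin 3) K, A * Aᵀ = 1 ∧ A.det = 1 ∧
      ∀ x x', frame p q *ᵥ x = frame p' q' *ᵥ x' → x' = A *ᵥ x := by
  have hdet := det_frame hp hq
  have hdet' := det_frame hp' hq'
  rw [hpq] at hdet'
  have hu' : IsUnit (frame p' q').det := by rw [hdet']; exact hc.isUnit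
  have hgram : frame p q * (frame p q)ᵀ = frame p' q' * (frame p' q')ᵀ := by
    rw [frame_mul_transpose hp hq, frame_mul_transpose hp' hq', hpq]
  have hmul := mul_nonsing_inv (frame p' q')ᵀ (by rwa [det_transpose])
  refine ⟨(frame p' q')⁻¹ * frame p q, ?_, ?_, fun x x' h => ?_⟩
  · rw [transpose_mul, transpose_nonsing_inv, Matrix.mul_assoc, ← Matrix.mul_assoc (frame p q),
      hgram, Matrix.mul_assoc, hmul, Matrix.mul_one, nonsing_inv_mul _ hu']
  · rw [det_mul, det_nonsing_inv, hdet, hdet', Ring.inverse_eq_inv', inv_mul_cancel₀ hc]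
  · rw [← mulVec_mulVec, h, mulVec_mulVec, nonsing_inv_mul _ hu', one_mulVec]

theorem sum_sub_sq_eq_iff [NeZero (2 : K)] {p q : Fin 3 → K} (hp : p ⬝ᵥ p = 1)
    (hq : q ⬝ᵥ q = 1) (l : K) : ∑ i, (p i - q i) ^ 2 = l ↔ p ⬝ᵥ q = 1 - l / 2 := by
  have key : ∑ i, (p i - q i) ^ 2 = p ⬝ᵥ p + q ⬝ᵥ q - 2 * p ⬝ᵥ q := by
    simp only [Fin.sum_univ_three, dotProduct_eq_three]; ring
  rw [key, hp, hq]
  have h2 : (2 : K) ≠ 0 := NeZero.ne 2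
  constructor
  · rintro rfl; field_simp; ring
  · intro h; rw [h]; field_simp; ring

end Vectors

section SignedRoots

variable {g₁ g₂ : ℂ} {g₃ : ℂ → ℂ}

/-- Two nonzero squares determine two roots each, and so does a third one that depends on the
product of the first two roots. -/
theorem natCard_signed_roots (h₁ : g₁ ≠ 0) (h₂ : g₂ ≠ 0)
    (h₃ : ∀ x y, x ^ 2 = g₁ → y ^ 2 = g₂ → g₃ (x * y) ≠ 0) :
    Nat.card {w : ℂ × ℂ × ℂ // w.1 ^ 2 = g₁ ∧ w.2.1 ^ 2 = g₂ ∧ w.2.2 ^ 2 = g₃ (w.1 * w.2.1)}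
      = 8 := by
  choose r hr using fun z : ℂ => IsAlgClosed.exists_pow_nat_eq z (n := 2) two_pos
  have unit_sq (e : ℤˣ) : ((e : ℤ) : ℂ) ^ 2 = 1 := by
    rcases Int.units_eq_one_or e with rfl | rfl <;> norm_num
  have root_sq (e : ℤˣ) (z : ℂ) : ((e : ℤ) * r z) ^ 2 = z := by
    rw [mul_pow, unit_sq, one_mul, hr]
  have root_inj {e e' : ℤˣ} {z : ℂ} (hz : z ≠ 0) (h : (e : ℤ) * r z = (e' : ℤ) * r z) :
      e = e' := by
    have hrz : r z ≠ 0 := fun h0 => hz (by rw [← hr z, h0, zero_pow two_ne_zero])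
    exact_mod_cast mul_right_cancel₀ hrz h
  have root_surj {x z : ℂ} (h : x ^ 2 = z) : ∃ e : ℤˣ, (e : ℤ) * r z = x := by
    rcases sq_eq_sq_iff_eq_or_eq_neg.mp (h.trans (hr z).symm) with h | h
    · exact ⟨1, by simp [h]⟩
    · exact ⟨-1, by simp [h]⟩
  let F : ℤˣ × ℤˣ × ℤˣ →
      {w : ℂ × ℂ × ℂ // w.1 ^ 2 = g₁ ∧ w.2.1 ^ 2 = g₂ ∧ w.2.2 ^ 2 = g₃ (w.1 * w.2.1)} :=
    fun e => ⟨((e.1 : ℤ) * r g₁, (e.2.1 : ℤ) * r g₂,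
      (e.2.2 : ℤ) * r (g₃ ((e.1 : ℤ) * r g₁ * ((e.2.1 : ℤ) * r g₂)))),
      root_sq _ _, root_sq _ _, root_sq _ _⟩
  have hF : Function.Bijective F := by
    constructor
    · rintro ⟨e₁, e₂, e₃⟩ ⟨f₁, f₂, f₃⟩ h
      have h := congrArg Subtype.val h
      simp only [F, Prod.mk.injEq] at h
      obtain ⟨ha, hb, hc⟩ := h
      obtain rfl := root_inj h₁ ha
      obtain rfl := root_inj h₂ hb
      obtain rfl := root_inj (h₃ _ _ (root_sq _ _) (root_sq _ _)) hc
      rfl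
    · rintro ⟨⟨x, y, z⟩, hx, hy, hz⟩
      dsimp only at hx hy hz
      obtain ⟨e₁, rfl⟩ := root_surj hx
      obtain ⟨e₂, rfl⟩ := root_surj hy
      obtain ⟨e₃, rfl⟩ := root_surj hz
      exact ⟨(e₁, e₂, e₃), rfl⟩
  rw [← Nat.card_eq_of_bijective F hF, Nat.card_eq_fintype_card]
  rfl

end SignedRoots

/-- The edges of `G6`, listed. -/
def G6.edge : Fin 7 → G6.E :=
  ![⟨{1, 2}, by decide⟩, ⟨{2, 3}, by decide⟩, ⟨{1, 3}, by decide⟩, ⟨{1, 4}, by decide⟩,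
    ⟨{3, 4}, by decide⟩, ⟨{2, 5}, by decide⟩, ⟨{4, 5}, by decide⟩]

/-- The inner product of two unit vectors at squared distance `lam e`. -/
noncomputable def edgeCos (lam : Finset ℕ → ℝ) (e : Finset ℕ) : ℂ := 1 - (lam e : ℂ) / 2

theorem G6.aeval_edgeCos_ne_zero {lam : Finset ℕ → ℝ} (hlam : Generic G6 lam)
    {P : MvPolynomial (Fin 7) ℚ} (pt : Fin 7 → ℚ) (hP : MvPolynomial.aeval pt P ≠ 0) :
    MvPolynomial.aeval (fun i => edgeCos lam (G6.edge i)) P ≠ 0 := by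
  have hinj : Function.Injective G6.edge := by decide
  have h := (hlam.2.comp G6.edge hinj).map' (f := Complex.ofRealAm.restrictScalars ℚ)
    Complex.ofReal_injective
  let sub : Fin 7 → MvPolynomial (Fin 7) ℚ :=
    fun i => 1 - MvPolynomial.C (1 / 2) * MvPolynomial.X i
  have hpt : (fun i => MvPolynomial.aeval (fun i => 2 - 2 * pt i) (sub i)) = pt := by
    funext i
    simp [sub]
    ring
  have hcos : (fun i => MvPolynomial.aeval (fun i => (lam (G6.edge i) : ℂ)) (sub i)) =
      fun i => edgeCos lam (G6.edge i) := by
    funext i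
    simp [sub, edgeCos]
    ring
  have hQ := h.aeval_ne_zero_of_eval_ne_zero (P := MvPolynomial.aeval sub P)
    (fun i => 2 - 2 * pt i) (by
      rwa [← MvPolynomial.coe_aeval_eq_eval, RingHom.coe_coe, MvPolynomial.comp_aeval_apply, hpt])
  rw [MvPolynomial.comp_aeval_apply] at hQ
  rwa [← hcos]

theorem map_unitGram {R S : Type*} [CommRing R] [CommRing S] (φ : R →+* S) (a b c : R) :
    φ (unitGram a b c) = unitGram (φ a) (φ b) (φ c) := by
  simp [unitGram, map_ofNat]

theorem map_hingeResultant {R S : Type*} [CommRing R] [CommRing S] (φ : R →+* S)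
    (a b c e f g h : R) : φ (hingeResultant a b c e f g h) =
      hingeResultant (φ a) (φ b) (φ c) (φ e) (φ f) (φ g) (φ h) := by
  simp [hingeResultant, hingeOffset, map_unitGram, map_ofNat]

open MvPolynomial in
/-- The quantities whose vanishing would make a triangle of `G6` degenerate do not vanish. -/
theorem G6.nondegenerate {lam : Finset ℕ → ℝ} (hlam : Generic G6 lam) :
    1 - edgeCos lam {1, 3} ^ 2 ≠ 0 ∧
    unitGram (edgeCos lam {1, 2}) (edgeCos lam {2, 3}) (edgeCos lam {1, 3}) ≠ 0 ∧
    unitGram (edgeCos lam {1, 4}) (edgeCos lam {3, 4}) (edgeCos lam {1, 3}) ≠ 0 ∧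
    hingeResultant (edgeCos lam {1, 2}) (edgeCos lam {2, 3}) (edgeCos lam {1, 3})
      (edgeCos lam {1, 4}) (edgeCos lam {3, 4}) 0 0 ≠ 0 ∧
    hingeResultant (edgeCos lam {1, 2}) (edgeCos lam {2, 3}) (edgeCos lam {1, 3})
      (edgeCos lam {1, 4}) (edgeCos lam {3, 4}) (edgeCos lam {2, 5}) (edgeCos lam {4, 5}) ≠ 0 := by
  have hc := aeval_edgeCos_ne_zero hlam (P := 1 - X 2 ^ 2) 0 (by simp)
  have h₁ := aeval_edgeCos_ne_zero hlam (P := unitGram (X 0) (X 1) (X 2)) 0 (by simp [unitGram])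
  have h₂ := aeval_edgeCos_ne_zero hlam (P := unitGram (X 3) (X 4) (X 2)) 0 (by simp [unitGram])
  have h₃ := aeval_edgeCos_ne_zero hlam
    (P := hingeResultant (X 0) (X 1) (X 2) (X 3) (X 4) 0 0) ![1, 0, 0, 0, 0, 0, 0]
    (by simp [hingeResultant, hingeOffset, unitGram])
  have h₄ := aeval_edgeCos_ne_zero hlam
    (P := hingeResultant (X 0) (X 1) (X 2) (X 3) (X 4) (X 5) (X 6)) ![1, 0, 0, 0, 0, 0, 0]
    (by simp [hingeResultant, hingeOffset, unitGram])
  rw [← AlgHom.coe_toRingHom] at hc h₁ h₂ h₃ h₄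
  rw [map_unitGram] at h₁ h₂
  rw [map_hingeResultant] at h₃ h₄
  simp only [AlgHom.coe_toRingHom, map_sub, map_one, map_pow, map_zero, aeval_X] at hc h₁ h₂ h₃ h₄
  exact ⟨hc, h₁, h₂, h₃, h₄⟩

theorem G6.realization_iff {lam : Finset ℕ → ℝ} {ρ : ℕ → Fin 3 → ℂ} :
    SphereRealization G6 ρ ∧ SphereInduces G6 ρ lam ↔
      (ρ 1 ⬝ᵥ ρ 1 = 1 ∧ ρ 2 ⬝ᵥ ρ 2 = 1 ∧ ρ 3 ⬝ᵥ ρ 3 = 1 ∧ ρ 4 ⬝ᵥ ρ 4 = 1 ∧ ρ 5 ⬝ᵥ ρ 5 = 1) ∧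
      ρ 1 ⬝ᵥ ρ 2 = edgeCos lam {1, 2} ∧ ρ 3 ⬝ᵥ ρ 2 = edgeCos lam {2, 3} ∧
      ρ 1 ⬝ᵥ ρ 3 = edgeCos lam {1, 3} ∧ ρ 1 ⬝ᵥ ρ 4 = edgeCos lam {1, 4} ∧
      ρ 3 ⬝ᵥ ρ 4 = edgeCos lam {3, 4} ∧ ρ 2 ⬝ᵥ ρ 5 = edgeCos lam {2, 5} ∧
      ρ 4 ⬝ᵥ ρ 5 = edgeCos lam {4, 5} := by
  have hunit : SphereRealization G6 ρ ↔ ρ 1 ⬝ᵥ ρ 1 = 1 ∧ ρ 2 ⬝ᵥ ρ 2 = 1 ∧ ρ 3 ⬝ᵥ ρ 3 = 1 ∧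
      ρ 4 ⬝ᵥ ρ 4 = 1 ∧ ρ 5 ⬝ᵥ ρ 5 = 1 := by
    simp [SphereRealization, G6, dotProduct, sq]
  rw [hunit]
  refine and_congr_right fun ⟨h1, h2, h3, h4, h5⟩ => ?_
  rw [dotProduct_comm (ρ 3) (ρ 2)]
  simp only [edgeCos, ← sum_sub_sq_eq_iff h1 h2, ← sum_sub_sq_eq_iff h2 h3,
    ← sum_sub_sq_eq_iff h1 h3, ← sum_sub_sq_eq_iff h1 h4, ← sum_sub_sq_eq_iff h3 h4,
    ← sum_sub_sq_eq_iff h2 h5, ← sum_sub_sq_eq_iff h4 h5]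
  constructor
  · intro h
    exact ⟨h 1 2 (by decide), h 2 3 (by decide), h 1 3 (by decide), h 1 4 (by decide),
      h 3 4 (by decide), h 2 5 (by decide), h 4 5 (by decide)⟩
  · rintro ⟨h12, h23, h13, h14, h34, h25, h45⟩
    have hlt (u v : ℕ) (huv : ({u, v} : Finset ℕ) ∈ G6.E) (hle : u < v) :
        ∑ i, (ρ u i - ρ v i) ^ 2 = (lam {u, v} : ℂ) := by
      have hv := G6.edge_sub _ huv (by simp : v ∈ ({u, v} : Finset ℕ))
      have hv' : v ≤ 5 := (by decide : ∀ w ∈ G6.V, w ≤ 5) v hv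
      interval_cases v <;> interval_cases u <;>
        first
        | assumption
        | exact absurd huv (by decide)
    intro u v huv
    rcases lt_trichotomy u v with h | rfl | h
    · exact hlt u v huv h
    · have := G6.edge_two _ huv
      simp at this
    · rw [Finset.pair_comm] at huv ⊢
      rw [← hlt v u huv h]
      exact Finset.sum_congr rfl fun i _ => by ring

/-- The signed volumes of the three triangles of a realization of `G6`. -/
noncomputable def G6.volumes (ρ : ℕ → Fin 3 → ℂ) : ℂ × ℂ × ℂ :=
  (tripleDet (ρ 1) (ρ 3) (ρ 2), tripleDet (ρ 1) (ρ 3) (ρ 4), tripleDet (ρ 2) (ρ 4) (ρ 5))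

theorem G6.volumes_eq_of_congruent {ρ ρ' : ℕ → Fin 3 → ℂ} (h : SphereCongruent G6 ρ ρ') :
    volumes ρ = volumes ρ' := by
  obtain ⟨A, -, hdet, hA⟩ := h
  simp only [volumes, hA 1 (by decide), hA 2 (by decide), hA 3 (by decide), hA 4 (by decide),
    hA 5 (by decide), tripleDet_mulVec, hdet, one_mul]

theorem G6.one_sub_dotProduct_sq_ne_zero {lam : Finset ℕ → ℝ} (hlam : Generic G6 lam)
    {ρ : ℕ → Fin 3 → ℂ} (h : SphereRealization G6 ρ ∧ SphereInduces G6 ρ lam) :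
    1 - (ρ 2 ⬝ᵥ ρ 4) ^ 2 ≠ 0 := by
  obtain ⟨⟨h1, h2, h3, h4, -⟩, h12, h23, h13, h14, h34, -⟩ := realization_iff.mp h
  intro h0
  refine (nondegenerate hlam).2.2.2.1 ?_
  rw [← h12, ← h23, ← h13, ← h14, ← h34]
  exact hingeResultant_eq_zero (tripleDet_sq h1 h3 h2) (tripleDet_sq h1 h3 h4)
    (tripleDet_mul_tripleDet h1 h3) (by simpa [unitGram] using h0)

theorem G6.congruent_of_volumes_eq {lam : Finset ℕ → ℝ} (hlam : Generic G6 lam)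
    {ρ ρ' : ℕ → Fin 3 → ℂ} (h : SphereRealization G6 ρ ∧ SphereInduces G6 ρ lam)
    (h' : SphereRealization G6 ρ' ∧ SphereInduces G6 ρ' lam) (hvol : volumes ρ = volumes ρ') :
    SphereCongruent G6 ρ ρ' := by
  have hdeg' := one_sub_dotProduct_sq_ne_zero hlam h'
  obtain ⟨⟨h1, h2, h3, h4, h5⟩, h12, h23, h13, h14, h34, h25, h45⟩ := realization_iff.mp h
  obtain ⟨⟨h1', h2', h3', h4', h5'⟩, h12', h23', h13', h14', h34', h25', h45'⟩ :=
    realization_iff.mp h'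
  simp only [volumes, Prod.mk.injEq] at hvol
  obtain ⟨hv2, hv4, hv5⟩ := hvol
  obtain ⟨A, hA, hdet, hframe⟩ := exists_rotation h1 h3 h1' h3' (by rw [h13, h13'])
    (by rw [h13]; exact (nondegenerate hlam).1)
  have e1 : ρ' 1 = A *ᵥ ρ 1 := hframe _ _ <| by
    rw [frame_mulVec, frame_mulVec, h1, h1', dotProduct_comm, h13, dotProduct_comm, h13']
    simp only [tripleDet_eq]
    ring_nf
  have e3 : ρ' 3 = A *ᵥ ρ 3 := hframe _ _ <| by
    rw [frame_mulVec, frame_mulVec, h3, h3', h13, h13']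
    simp only [tripleDet_eq]
    ring_nf
  have e2 : ρ' 2 = A *ᵥ ρ 2 := hframe _ _ <| by
    rw [frame_mulVec, frame_mulVec, h12, h12', h23, h23', hv2]
  have e4 : ρ' 4 = A *ᵥ ρ 4 := hframe _ _ <| by
    rw [frame_mulVec, frame_mulVec, h14, h14', h34, h34', hv4]
  have e5 : ρ' 5 = A *ᵥ ρ 5 := by
    refine eq_of_frame_mulVec_eq h2' h4' hdeg' ?_
    rw [frame_mulVec, frame_mulVec, h25', h45', ← hv5, e2, e4, mulVec_dotProduct_mulVec hA,
      mulVec_dotProduct_mulVec hA, tripleDet_mulVec, hdet, one_mul, h25, h45]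
  refine ⟨A, hA, hdet, fun v hv => ?_⟩
  simp only [G6, Finset.mem_insert, Finset.mem_singleton] at hv
  rcases hv with rfl | rfl | rfl | rfl | rfl <;> assumption

/-- The square of the volume of the triangle `{2, 4, 5}`, as a function of the product of the
volumes of the triangles `{1, 2, 3}` and `{1, 3, 4}`. -/
noncomputable def G6.lastGram (lam : Finset ℕ → ℝ) (w : ℂ) : ℂ :=
  unitGram (edgeCos lam {2, 5}) (edgeCos lam {4, 5})
    ((w - hingeOffset (edgeCos lam {1, 2}) (edgeCos lam {2, 3}) (edgeCos lam {1, 3})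
      (edgeCos lam {1, 4}) (edgeCos lam {3, 4})) / (1 - edgeCos lam {1, 3} ^ 2))

theorem G6.volumes_mem {lam : Finset ℕ → ℝ} (hlam : Generic G6 lam)
    {ρ : ℕ → Fin 3 → ℂ} (h : SphereRealization G6 ρ ∧ SphereInduces G6 ρ lam) :
    (volumes ρ).1 ^ 2 =
      unitGram (edgeCos lam {1, 2}) (edgeCos lam {2, 3}) (edgeCos lam {1, 3}) ∧
    (volumes ρ).2.1 ^ 2 =
      unitGram (edgeCos lam {1, 4}) (edgeCos lam {3, 4}) (edgeCos lam {1, 3}) ∧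
    (volumes ρ).2.2 ^ 2 = lastGram lam ((volumes ρ).1 * (volumes ρ).2.1) := by
  have hc := (nondegenerate hlam).1
  obtain ⟨⟨h1, h2, h3, h4, h5⟩, h12, h23, h13, h14, h34, h25, h45⟩ := realization_iff.mp h
  dsimp only [volumes]
  refine ⟨by rw [tripleDet_sq h1 h3 h2, h12, h23, h13],
    by rw [tripleDet_sq h1 h3 h4, h14, h34, h13], ?_⟩
  rw [tripleDet_sq h2 h4 h5, tripleDet_mul_tripleDet h1 h3, h12, h23, h13, h14, h34, h25, h45,
    lastGram, add_sub_cancel_right, mul_div_cancel_left₀ _ hc]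

theorem G6.exists_realization {lam : Finset ℕ → ℝ} (hlam : Generic G6 lam) {x y z : ℂ}
    (hx : x ^ 2 = unitGram (edgeCos lam {1, 2}) (edgeCos lam {2, 3}) (edgeCos lam {1, 3}))
    (hy : y ^ 2 = unitGram (edgeCos lam {1, 4}) (edgeCos lam {3, 4}) (edgeCos lam {1, 3}))
    (hz : z ^ 2 = lastGram lam (x * y)) :
    ∃ ρ, (SphereRealization G6 ρ ∧ SphereInduces G6 ρ lam) ∧ volumes ρ = (x, y, z) := by
  obtain ⟨hc, -, -, hres, -⟩ := nondegenerate hlam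
  obtain ⟨r, hr⟩ := IsAlgClosed.exists_pow_nat_eq (1 - edgeCos lam {1, 3} ^ 2) two_pos
  let p1 : Fin 3 → ℂ := ![1, 0, 0]
  let p3 : Fin 3 → ℂ := ![edgeCos lam {1, 3}, r, 0]
  have h1 : p1 ⬝ᵥ p1 = 1 := by simp [p1]
  have h3 : p3 ⬝ᵥ p3 = 1 := by
    simp only [p3, dotProduct_eq_three, cons_val]
    linear_combination hr
  have h13 : p1 ⬝ᵥ p3 = edgeCos lam {1, 3} := by simp [p1, p3]
  rw [← h13] at hx hy hc hres
  obtain ⟨p2, h2, h12, h32, hx'⟩ := exists_unit_vector h1 h3 hc hx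
  obtain ⟨p4, h4, h14, h34, hy'⟩ := exists_unit_vector h1 h3 hc hy
  have hxy := tripleDet_mul_tripleDet (x := p2) (y := p4) h1 h3
  rw [hx', hy', h12, h32, h14, h34] at hxy
  have hdeg : 1 - (p2 ⬝ᵥ p4) ^ 2 ≠ 0 := fun h0 =>
    hres (hingeResultant_eq_zero hx hy hxy (by simpa [unitGram] using h0))
  rw [lastGram, ← h13, hxy, add_sub_cancel_right, mul_div_cancel_left₀ _ hc] at hz
  obtain ⟨p5, h5, h25, h45, hz'⟩ := exists_unit_vector h2 h4 hdeg hz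
  refine ⟨fun v => ![0, p1, p2, p3, p4, p5] (Fin.ofNat 6 v), realization_iff.mpr ?_, ?_⟩
  · exact ⟨⟨h1, h2, h3, h4, h5⟩, h12, h32, h13, h14, h34, h25, h45⟩
  · change (tripleDet p1 p3 p2, tripleDet p1 p3 p4, tripleDet p2 p4 p5) = _
    rw [hx', hy', hz']

/-- This graph has exactly `8` congruence classes of spherical realizations for
every generic edge-length assignment. -/
theorem sphere_count_G6 (lam : Finset ℕ → ℝ) (hlam : Generic G6 lam) :
    Finite (SphereClasses G6 lam) ∧ Nat.card (SphereClasses G6 lam) = 8 := by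
  obtain ⟨hc, h₁, h₂, -, hres⟩ := G6.nondegenerate hlam
  have hlast (x y : ℂ)
      (hx : x ^ 2 = unitGram (edgeCos lam {1, 2}) (edgeCos lam {2, 3}) (edgeCos lam {1, 3}))
      (hy : y ^ 2 = unitGram (edgeCos lam {1, 4}) (edgeCos lam {3, 4}) (edgeCos lam {1, 3})) :
      G6.lastGram lam (x * y) ≠ 0 := fun h0 =>
    hres (hingeResultant_eq_zero hx hy (by rw [mul_div_cancel₀ _ hc, sub_add_cancel]) h0)
  let F : SphereClasses G6 lam → {w : ℂ × ℂ × ℂ // w.1 ^ 2 = _ ∧ w.2.1 ^ 2 = _ ∧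
      w.2.2 ^ 2 = G6.lastGram lam (w.1 * w.2.1)} :=
    Quot.lift (fun ρ => ⟨G6.volumes ρ.1, G6.volumes_mem hlam ρ.2⟩)
      fun _ _ h => Subtype.ext (G6.volumes_eq_of_congruent h)
  have hF : Function.Bijective F := by
    constructor
    · rintro ⟨ρ⟩ ⟨ρ'⟩ h
      exact Quot.sound (G6.congruent_of_volumes_eq hlam ρ.2 ρ'.2 (congrArg Subtype.val h))
    · rintro ⟨⟨x, y, z⟩, hx, hy, hz⟩
      obtain ⟨ρ, hρ, hvol⟩ := G6.exists_realization hlam hx hy hz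
      exact ⟨Quot.mk _ ⟨ρ, hρ⟩, Subtype.ext hvol⟩
  have hcard := (Nat.card_eq_of_bijective F hF).trans (natCard_signed_roots h₁ h₂ hlast)
  exact ⟨Nat.finite_of_card_ne_zero (by rw [hcard]; norm_num), hcard⟩
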